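/- arXiv:1004.2305 — 2 statements merged into one kernel-verified Lean document; each statement's English description precedes it below -/
import Mathlib

section
/- Let Γ be a Cayley tree of order 2 with vertex set V, let m ≥ 2, and let K be a finite connected full subgraph of Γ with exactly m boundary vertices (so K has 2m−2 vertices in total). Then for every n ≥ 2m−2, the number of subsets S ⊆ V with |S| = n, containing all vertices of K, such that the subgraph of Γ induced on S is connected, equals F(n,m) = ∑ C_{r_1}·C_{r_2}·…·C_{r_m}, where the sum is over all m-tuples (r_1,…,r_m) of integers with each r_i ≥ 1 and r_1+⋯+r_m = n−m+2, and C_k denotes the k-th Catalan number. -/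
/-- `F n m` = ∑ C_{r₁}⋯C_{r_m} over m-tuples of integers r_i ≥ 1 with r₁+⋯+r_m = n−m+2. -/
def Fcount (n m : ℕ) : ℕ :=
  ∑ r ∈ (Finset.Nat.antidiagonalTuple m (n - m + 2)).filter (fun r => ∀ i, 1 ≤ r i),
    ∏ i, catalan (r i)

namespace PowerSeries

lemma coeff_pow_eq_sum_antidiagonalTuple {R : Type*} [CommSemiring R] (f : R⟦X⟧) (m N : ℕ) :
    coeff N (f ^ m) = ∑ r ∈ Finset.Nat.antidiagonalTuple m N, ∏ i, coeff (r i) f := by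
  have h := coeff_prod (fun _ : Fin m ↦ f) N Finset.univ
  rw [Finset.prod_const, Finset.card_univ, Fintype.card_fin] at h
  rw [h]
  refine Finset.sum_bij (fun l _ ↦ ⇑l) ?_ ?_ ?_ ?_
  · intro l hl
    rw [Finset.mem_finsuppAntidiag] at hl
    exact Finset.Nat.mem_antidiagonalTuple.2 hl.1
  · intro l _ l' _ hll
    exact DFunLike.coe_injective hll
  · intro r hr
    refine ⟨Finsupp.equivFunOnFinite.symm r, ?_, rfl⟩
    rw [Finset.mem_finsuppAntidiag]
    exact ⟨Finset.Nat.mem_antidiagonalTuple.1 hr, Finset.subset_univ _⟩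
  · intro l _
    rfl

lemma coeff_catalanSeries_sq_mul_X (r : ℕ) :
    coeff r (catalanSeries ^ 2 * X) = if 1 ≤ r then catalan r else 0 := by
  cases r with
  | zero => simp
  | succ r =>
    have h := congrArg (coeff (r + 1)) catalanSeries_sq_mul_X_add_one
    rw [map_add, catalanSeries_coeff, coeff_one, if_neg r.succ_ne_zero, add_zero] at h
    simpa using h

lemma coeff_succ_catalanSeries_pow_succ (k f : ℕ) :
    coeff (k + 1) (catalanSeries ^ (f + 1)) =
      coeff k (catalanSeries ^ (f + 2)) + coeff (k + 1) (catalanSeries ^ f) := by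
  have h : catalanSeries ^ (f + 1) = catalanSeries ^ (f + 2) * X + catalanSeries ^ f := by
    calc catalanSeries ^ (f + 1)
        = catalanSeries ^ f * (catalanSeries ^ 2 * X + 1) := by
          rw [catalanSeries_sq_mul_X_add_one, pow_succ]
      _ = _ := by ring
  rw [h, map_add, coeff_succ_mul_X]

end PowerSeries

lemma Fcount_eq_coeff_catalanSeries_pow (k m : ℕ) (hm : 2 ≤ m) :
    Fcount (2 * m - 2 + k) m =
      PowerSeries.coeff k (PowerSeries.catalanSeries ^ (2 * m)) := by
  have hN : 2 * m - 2 + k - m + 2 = k + m := by omega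
  have h : Fcount (2 * m - 2 + k) m =
      PowerSeries.coeff (k + m) ((PowerSeries.catalanSeries ^ 2 * PowerSeries.X) ^ m) := by
    rw [Fcount, hN, PowerSeries.coeff_pow_eq_sum_antidiagonalTuple, Finset.sum_filter]
    refine Finset.sum_congr rfl fun r _ ↦ ?_
    simp_rw [PowerSeries.coeff_catalanSeries_sq_mul_X]
    rw [Finset.prod_ite_zero]
    simp
  rw [h, mul_pow, PowerSeries.coeff_mul_X_pow, pow_mul]

namespace SimpleGraph

variable {V : Type*} {G : SimpleGraph V}

/-- The vertices outside `A` that are adjacent to a vertex of `A`. -/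
def outerBoundary (G : SimpleGraph V) (A : Set V) : Set V :=
  {v | v ∉ A ∧ ∃ a ∈ A, G.Adj a v}

/-- The connected vertex sets containing `A`, avoiding `B`, with exactly `k` vertices
outside `A`. -/
def connectedSupersets (G : SimpleGraph V) (A B : Set V) (k : ℕ) : Set (Set V) :=
  {S | S.Finite ∧ S.ncard = A.ncard + k ∧ A ⊆ S ∧ Disjoint S B ∧ (G.induce S).Connected}

lemma Connected.outerBoundary_inter_nonempty {A S : Set V} (hS : (G.induce S).Connected)
    (hA : A.Nonempty) (h : A ⊂ S) : (G.outerBoundary A ∩ S).Nonempty := by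
  obtain ⟨a, ha⟩ := hA
  obtain ⟨s, hs, hsA⟩ := Set.exists_of_ssubset h
  obtain ⟨p⟩ := hS.preconnected ⟨a, h.subset ha⟩ ⟨s, hs⟩
  obtain ⟨d, -, hd₁, hd₂⟩ := p.exists_boundary_dart (Subtype.val ⁻¹' A) ha hsA
  exact ⟨d.snd, ⟨hd₂, d.fst, hd₁, d.adj⟩, d.snd.2⟩

lemma IsAcyclic.eq_of_adj_of_connected (hG : G.IsAcyclic) {A : Set V}
    (hA : (G.induce A).Connected) {x a b : V} (hx : x ∉ A) (ha : a ∈ A) (hb : b ∈ A)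
    (hax : G.Adj a x) (hbx : G.Adj b x) : a = b := by
  classical
  by_contra hab
  obtain ⟨p, hp⟩ := (hA.preconnected ⟨a, ha⟩ ⟨b, hb⟩).exists_isPath
  let q : G.Walk a b := p.map (Embedding.induce A).toHom
  have hq : q.IsPath := hp.map Subtype.val_injective
  let r : G.Walk a b := .cons hax (.cons hbx.symm .nil)
  have hr : r.IsPath := by
    simp [r, hab, hax.ne, hbx.ne']
  have hqr := congrArg Subtype.val ((hG.subsingleton_path a b).elim ⟨q, hq⟩ ⟨r, hr⟩)
  have hxr : x ∈ q.support := by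
    change q = r at hqr
    simp [hqr, r]
  have hsupp : q.support = p.support.map Subtype.val := Walk.support_map _ p
  rw [hsupp, List.mem_map] at hxr
  obtain ⟨y, -, rfl⟩ := hxr
  exact hx y.2

lemma Connected.induce_insert {A : Set V} (hA : (G.induce A).Connected) {a b : V} (ha : a ∈ A)
    (hab : G.Adj a b) : (G.induce (insert b A)).Connected := by
  rw [← Set.singleton_union, Set.union_comm]
  refine connected_induce_union (v := a) (w := b) ?_ ?_ ha rfl hab
  · exact hA.preconnected
  · exact Preconnected.of_subsingleton

lemma outerBoundary_insert_diff (hG : G.IsAcyclic) {A B : Set V} (hA : (G.induce A).Connected)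
    (hB : B ⊆ G.outerBoundary A) {a b : V} (ha : a ∈ A) (hab : G.Adj a b) (hb : b ∉ A) :
    G.outerBoundary (insert b A) \ B =
        (G.outerBoundary A \ B) \ {b} ∪ G.neighborSet b \ {a} ∧
      Disjoint ((G.outerBoundary A \ B) \ {b}) (G.neighborSet b \ {a}) := by
  have hnbr : ∀ x ∈ G.neighborSet b \ {a}, x ∉ A ∧ x ∉ G.outerBoundary A := by
    rintro x ⟨hbx : G.Adj b x, hxa⟩
    have hxA : x ∉ A := fun hxA ↦
      hxa (hG.eq_of_adj_of_connected hA hb hxA ha hbx.symm hab)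
    refine ⟨hxA, ?_⟩
    rintro ⟨-, c, hc, hcx⟩
    have hxb : x ∉ insert b A := by
      rintro (rfl | h)
      · exact G.loopless.irrefl _ hbx
      · exact hxA h
    have := hG.eq_of_adj_of_connected (hA.induce_insert ha hab) hxb (Set.mem_insert_of_mem b hc)
      (Set.mem_insert b A) hcx hbx
    exact hb (this ▸ hc)
  constructor
  · ext x
    constructor
    · rintro ⟨⟨hx, c, hc, hcx⟩, hxB⟩
      rw [Set.mem_insert_iff, not_or] at hx
      rcases hc with rfl | hc
      · exact .inr ⟨hcx, fun h ↦ hx.2 (h ▸ ha)⟩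
      · exact .inl ⟨⟨⟨hx.2, c, hc, hcx⟩, hxB⟩, hx.1⟩
    · rintro (⟨⟨⟨hx, c, hc, hcx⟩, hxB⟩, hxb⟩ | hx)
      · refine ⟨⟨?_, c, Set.mem_insert_of_mem b hc, hcx⟩, hxB⟩
        rw [Set.mem_insert_iff, not_or]
        exact ⟨hxb, hx⟩
      · obtain ⟨hxA, hxO⟩ := hnbr x hx
        refine ⟨⟨?_, b, Set.mem_insert b A, hx.1⟩, fun h ↦ hxO (hB h)⟩
        rw [Set.mem_insert_iff, not_or]
        exact ⟨fun h ↦ G.loopless.irrefl b (h ▸ hx.1), hxA⟩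
  · rw [Set.disjoint_left]
    exact fun x hx hx' ↦ (hnbr x hx').2 hx.1.1

lemma connectedSupersets_zero {A B : Set V} (hfin : A.Finite) (hA : (G.induce A).Connected)
    (hAB : Disjoint A B) : G.connectedSupersets A B 0 = {A} := by
  ext S
  constructor
  · rintro ⟨hS, hcard, hAS, -, -⟩
    exact (Set.eq_of_subset_of_ncard_le hAS (by omega) hS).symm
  · rintro rfl
    exact ⟨hfin, rfl, subset_rfl, hAB, hA⟩

lemma connectedSupersets_succ_eq_empty {A B : Set V} (hA : A.Nonempty)
    (hAB : G.outerBoundary A ⊆ B) (k : ℕ) : G.connectedSupersets A B (k + 1) = ∅ := by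
  rw [Set.eq_empty_iff_forall_notMem]
  rintro S ⟨hS, hcard, hAS, hSB, hconn⟩
  have hne : A ≠ S := by
    rintro rfl
    omega
  obtain ⟨x, hx, hxS⟩ := hconn.outerBoundary_inter_nonempty hA (hAS.ssubset_of_ne hne)
  exact Set.disjoint_left.1 hSB hxS (hAB hx)

lemma connectedSupersets_succ {A B : Set V} (hfin : A.Finite) {b : V} (hbA : b ∉ A) (k : ℕ) :
    G.connectedSupersets A B (k + 1) =
      G.connectedSupersets (insert b A) B k ∪ G.connectedSupersets A (insert b B) (k + 1) := by
  ext S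
  have hcard : (insert b A).ncard + k = A.ncard + (k + 1) := by
    rw [Set.ncard_insert_of_notMem hbA hfin]
    ring
  simp only [connectedSupersets, Set.mem_union, Set.mem_ofPred_eq, hcard, Set.insert_subset_iff,
    Set.disjoint_insert_right]
  tauto

lemma disjoint_connectedSupersets_insert (A B : Set V) (b : V) (k l : ℕ) :
    Disjoint (G.connectedSupersets (insert b A) B k)
      (G.connectedSupersets A (insert b B) l) := by
  rw [Set.disjoint_left]
  rintro S ⟨-, -, hAS, -, -⟩ ⟨-, -, -, hSB, -⟩
  exact Set.disjoint_left.1 hSB (hAS (Set.mem_insert b A)) (Set.mem_insert b B)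

lemma IsAcyclic.encard_connectedSupersets (hG : G.IsAcyclic)
    (hdeg : ∀ v : V, (G.neighborSet v).ncard = 3) (k : ℕ) :
    ∀ (f : ℕ) (A B : Set V), A.Finite → (G.induce A).Connected → B ⊆ G.outerBoundary A →
      (G.outerBoundary A \ B).encard = f →
      (G.connectedSupersets A B k).encard =
        (PowerSeries.coeff k (PowerSeries.catalanSeries ^ f) : ℕ) := by
  induction k with
  | zero =>
    intro f A B hfin hA hB _
    have hAB : Disjoint A B := Set.disjoint_left.2 fun x hx hxB ↦ (hB hxB).1 hx
    rw [connectedSupersets_zero hfin hA hAB, Set.encard_singleton]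
    simp
  | succ k ihk =>
    intro f
    induction f with
    | zero =>
      intro A B hfin hA hB hf
      have hne : A.Nonempty := Set.nonempty_coe_sort.1 hA.nonempty
      rw [Nat.cast_zero, Set.encard_eq_zero, Set.sdiff_eq_empty] at hf
      rw [connectedSupersets_succ_eq_empty hne hf]
      simp [PowerSeries.coeff_one]
    | succ f ihf =>
      intro A B hfin hA hB hf
      obtain ⟨b, ⟨hbA, a, ha, hab⟩, hbB⟩ : (G.outerBoundary A \ B).Nonempty := by
        rw [← Set.encard_ne_zero, hf]
        exact_mod_cast f.succ_ne_zero
      have hb : b ∈ G.outerBoundary A := ⟨hbA, a, ha, hab⟩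
      have herase : ((G.outerBoundary A \ B) \ {b}).encard = f := by
        have := Set.encard_sdiff_singleton_add_one (a := b) (s := G.outerBoundary A \ B) ⟨hb, hbB⟩
        rw [hf, Nat.cast_succ] at this
        exact ENat.add_left_injective_of_ne_top ENat.one_ne_top this
      have hnbr : (G.neighborSet b \ {a}).encard = 2 := by
        have hfin : (G.neighborSet b).Finite :=
          Set.finite_of_ncard_pos (by rw [hdeg]; norm_num)
        have h := Set.ncard_sdiff_singleton_add_one (s := G.neighborSet b) (a := a) hab.symm hfin
        rw [hdeg] at h
        rw [← (hfin.sdiff).cast_ncard_eq]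
        norm_cast
        omega
      rw [connectedSupersets_succ hfin hbA, Set.encard_union_eq
        (disjoint_connectedSupersets_insert A B b k (k + 1)),
        PowerSeries.coeff_succ_catalanSeries_pow_succ, Nat.cast_add]
      congr 1
      · obtain ⟨heq, hdisj⟩ := outerBoundary_insert_diff hG hA hB ha hab hbA
        refine ihk (f + 2) _ _ (hfin.insert b) (hA.induce_insert ha hab) ?_ ?_
        · intro x hx
          obtain ⟨hxA, c, hc, hcx⟩ := hB hx
          refine ⟨?_, c, Set.mem_insert_of_mem b hc, hcx⟩
          rintro (rfl | h)
          · exact hbB hx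
          · exact hxA h
        · rw [heq, Set.encard_union_eq hdisj, herase, hnbr]
          norm_cast
      · refine ihf _ _ hfin hA (Set.insert_subset hb hB) ?_
        rw [← herase, Set.sdiff_sdiff, Set.union_singleton]

lemma IsAcyclic.subgraph_adj (hG : G.IsAcyclic) {K : G.Subgraph} (hK : K.Connected) {a b : V}
    (ha : a ∈ K.verts) (hb : b ∈ K.verts) (hab : G.Adj a b) : K.Adj a b := by
  obtain ⟨p, hp⟩ := (hK.coe.preconnected ⟨a, ha⟩ ⟨b, hb⟩).exists_isPath
  have hq : (p.map K.hom).IsPath := hp.map K.hom_injective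
  have h := congrArg Subtype.val ((hG.subsingleton_path a b).elim ⟨_, hq⟩ (Path.singleton hab))
  have hlen : p.length = 1 := by
    rw [← Walk.length_map K.hom p]
    exact congrArg Walk.length h
  exact Walk.adj_of_length_eq_one hlen

lemma IsAcyclic.sum_ncard_neighborSet_subgraph (hG : G.IsAcyclic) {K : G.Subgraph}
    (hK : K.Connected) (hfin : K.verts.Finite) :
    ∑ v ∈ hfin.toFinset, (K.neighborSet v).ncard + 2 = 2 * K.verts.ncard := by
  classical
  have := hfin.fintype
  have hT : K.coe.IsTree := ⟨hK.coe, hG.subgraph K⟩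
  have h₁ := hT.card_edgeFinset
  have h₂ := K.coe.sum_degrees_eq_twice_card_edges
  have h₃ : ∑ v ∈ hfin.toFinset, (K.neighborSet v).ncard = 2 * K.coe.edgeFinset.card := by
    rw [← h₂]
    rw [← Finset.sum_subtype hfin.toFinset (fun _ ↦ hfin.mem_toFinset)
      (f := fun v ↦ (K.neighborSet v).ncard) |>.symm]
    refine Finset.sum_congr rfl fun v _ ↦ ?_
    rw [← Nat.card_coe_set_eq, Nat.card_congr (K.coeNeighborSetEquiv v).symm,
      Nat.card_eq_fintype_card, card_neighborSet_eq_degree]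
    congr!
  rw [h₃, ← Nat.card_coe_set_eq, Nat.card_eq_fintype_card, ← h₁]
  ring

/-- In a cubic forest, every vertex of `K` of degree one in `K` contributes two vertices to the
outer boundary, and the other vertices contribute none. -/
lemma IsAcyclic.ncard_outerBoundary_subgraph (hG : G.IsAcyclic)
    (hdeg : ∀ v : V, (G.neighborSet v).ncard = 3) {K : G.Subgraph} (hK : K.Connected)
    (hfin : K.verts.Finite)
    (h13 : ∀ x ∈ K.verts, (K.neighborSet x).ncard = 1 ∨ (K.neighborSet x).ncard = 3) :
    (G.outerBoundary K.verts).Finite ∧ (G.outerBoundary K.verts).ncard =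
      2 * {x ∈ K.verts | (K.neighborSet x).ncard = 1}.ncard := by
  classical
  have hGfin : ∀ v, (G.neighborSet v).Finite := fun v ↦
    Set.finite_of_ncard_pos (by rw [hdeg]; norm_num)
  have hBfin : {x ∈ K.verts | (K.neighborSet x).ncard = 1}.Finite := hfin.subset fun x hx ↦ hx.1
  let T : V → Finset V := fun a ↦ ((hGfin a).sdiff (t := K.neighborSet a)).toFinset
  have hT : ∀ a v, v ∈ T a ↔ G.Adj a v ∧ ¬ K.Adj a v := by
    intro a v
    simp only [T, Set.Finite.mem_toFinset, Set.mem_sdiff, mem_neighborSet,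
      Subgraph.mem_neighborSet]
  have hTout : ∀ a ∈ K.verts, ∀ v ∈ T a, v ∉ K.verts := fun a ha v hv hvK ↦
    ((hT a v).1 hv).2 (hG.subgraph_adj hK ha hvK ((hT a v).1 hv).1)
  have heq : G.outerBoundary K.verts = hBfin.toFinset.biUnion T := by
    ext v
    simp only [Finset.coe_biUnion, Set.mem_iUnion, Finset.mem_coe, Set.Finite.mem_toFinset]
    constructor
    · rintro ⟨hv, a, ha, hav⟩
      have hKav : ¬ K.Adj a v := fun h ↦ hv h.snd_mem
      refine ⟨a, ⟨ha, (h13 a ha).resolve_right fun h3 ↦ hKav ?_⟩, (hT a v).2 ⟨hav, hKav⟩⟩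
      have := Set.eq_of_subset_of_ncard_le (K.neighborSet_subset a) (by rw [h3, hdeg]) (hGfin a)
      exact this.ge hav
    · rintro ⟨a, ha, hv⟩
      exact ⟨hTout a ha.1 v hv, a, ha.1, ((hT a v).1 hv).1⟩
  have hcard : ∀ a ∈ hBfin.toFinset, (T a).card = 2 := by
    intro a ha
    rw [Set.Finite.mem_toFinset] at ha
    rw [← Set.ncard_eq_toFinset_card _ (hGfin a).sdiff, Set.ncard_sdiff (K.neighborSet_subset a)
      ((hGfin a).subset (K.neighborSet_subset a)), hdeg, ha.2]
  have hdisj : (hBfin.toFinset : Set V).PairwiseDisjoint T := by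
    intro a ha b hb hab
    rw [Finset.mem_coe, Set.Finite.mem_toFinset] at ha hb
    refine Finset.disjoint_left.2 fun v hva hvb ↦ hab ?_
    exact hG.eq_of_adj_of_connected hK.induce_verts (hTout a ha.1 v hva) ha.1 hb.1
      ((hT a v).1 hva).1 ((hT b v).1 hvb).1
  rw [heq, Set.ncard_coe_finset, Finset.card_biUnion hdisj, Finset.sum_congr rfl hcard,
    Finset.sum_const, ← Set.ncard_eq_toFinset_card _ hBfin, smul_eq_mul, mul_comm]
  exact ⟨Finset.finite_toSet _, rfl⟩

end SimpleGraph

/-- Let Γ be a Cayley tree of order 2, m ≥ 2, and K a finite connected full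
subgraph with exactly m boundary vertices. Then for every n ≥ 2m−2, the number of n-element
subsets S of V containing all vertices of K whose induced subgraph is connected equals
F(n,m). -/
theorem stmt_3 {V : Type*} (G : SimpleGraph V)
    (hconn : G.Connected) (hacyc : G.IsAcyclic)
    (hdeg : ∀ v : V, (G.neighborSet v).ncard = 3)
    (K : G.Subgraph) (hKfin : K.verts.Finite) (hKconn : K.Connected)
    (m : ℕ) (hm : 2 ≤ m)
    (hfull : ∀ x ∈ K.verts, 2 ≤ (K.neighborSet x).ncard → (K.neighborSet x).ncard = 3)
    (hbdry : {x ∈ K.verts | (K.neighborSet x).ncard = 1}.ncard = m) :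
    ∀ n : ℕ, 2 * m - 2 ≤ n →
      {S : Set V | S.Finite ∧ S.ncard = n ∧ K.verts ⊆ S ∧ (G.induce S).Connected}.ncard =
        Fcount n m := by
  classical
  set E : Set V := {x ∈ K.verts | (K.neighborSet x).ncard = 1} with hE
  have hEK : E ⊆ K.verts := fun x hx ↦ hx.1
  have hnt : Nontrivial K.verts := by
    rw [Set.nontrivial_coe_sort]
    have := Set.ncard_le_ncard hEK hKfin
    exact (Set.one_lt_ncard_iff_nontrivial_and_finite.1 (by omega)).1
  have h13 : ∀ x ∈ K.verts, (K.neighborSet x).ncard = 1 ∨ (K.neighborSet x).ncard = 3 := by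
    intro x hx
    have hfin : (K.neighborSet x).Finite := hKfin.subset (K.neighborSet_subset_verts x)
    have hpos : 0 < (K.neighborSet x).ncard := by
      obtain ⟨y, hy⟩ := hKconn.preconnected.exists_adj_of_nontrivial ⟨x, hx⟩
      exact (Set.ncard_pos hfin).2 ⟨y, hy⟩
    by_cases h : 2 ≤ (K.neighborSet x).ncard
    · exact .inr (hfull x hx h)
    · exact .inl (by omega)
  obtain ⟨hDfin, hD⟩ := hacyc.ncard_outerBoundary_subgraph hdeg hKconn hKfin h13
  have hKcard : K.verts.ncard = 2 * m - 2 := by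
    have hsum := hacyc.sum_ncard_neighborSet_subgraph hKconn hKfin
    have hdeg' : ∑ v ∈ hKfin.toFinset, (K.neighborSet v).ncard + 2 * m = 3 * K.verts.ncard := by
      have hm' : m = ∑ v ∈ hKfin.toFinset, if (K.neighborSet v).ncard = 1 then 1 else 0 := by
        rw [Finset.sum_boole, Nat.cast_id, ← hbdry, ← Set.ncard_coe_finset]
        congr 1
        ext x
        simp [hE]
      rw [hm', Finset.mul_sum, ← Finset.sum_add_distrib,
        Set.ncard_eq_toFinset_card _ hKfin, mul_comm, ← smul_eq_mul, ← Finset.sum_const]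
      refine Finset.sum_congr rfl fun v hv ↦ ?_
      rcases h13 v (hKfin.mem_toFinset.1 hv) with h | h <;> simp [h]
    omega
  intro n hn
  obtain ⟨k, rfl⟩ := Nat.exists_eq_add_of_le hn
  have hmain := hacyc.encard_connectedSupersets hdeg k (2 * m) K.verts ∅ hKfin
    hKconn.induce_verts (Set.empty_subset _) (by
      rw [Set.sdiff_empty, ← hDfin.cast_ncard_eq, hD, hbdry])
  rw [Fcount_eq_coeff_catalanSeries_pow k m hm, Set.ncard_def]
  simp only [SimpleGraph.connectedSupersets, Set.disjoint_empty, true_and, hKcard] at hmain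
  rw [hmain, ENat.toNat_natCast]
end

section
/- Let Γ be a Cayley tree of order 2 with vertex set V, let m ≥ 2, and let x and y be two vertices of Γ at graph distance m−1 (so the shortest path joining x and y has m vertices). Then for every n ≥ m, the number of subsets S ⊆ V with |S| = n containing both x and y, such that the subgraph of Γ induced on S is connected, equals T(n,m) = ∑ C_{r_1}·C_{r_2}·…·C_{r_m}, where the sum is over all m-tuples (r_1,…,r_m) of nonnegative integers with r_1 ≥ 1, r_m ≥ 1 and r_1+⋯+r_m = n−m+2, and C_k denotes the k-th Catalan number. -/
/-- `T n m` = ∑ C_{r₁}⋯C_{r_m} over m-tuples of nonnegative integers with r₁ ≥ 1, r_m ≥ 1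
and r₁+⋯+r_m = n−m+2. -/
def Tcount (n m : ℕ) : ℕ :=
  ∑ r ∈ (Finset.Nat.antidiagonalTuple m (n - m + 2)).filter
      (fun r => ∀ i : Fin m, ((i : ℕ) = 0 ∨ (i : ℕ) = m - 1) → 1 ≤ r i),
    ∏ i, catalan (r i)

open Finset PowerSeries Relation

section Counting

variable {V : Type*}

/-- For every `k < N` the family `A` has exactly `coeff k f` members of cardinality `k`. -/
def CountsBelow (N : ℕ) (A : Set (Finset V)) (f : ℕ⟦X⟧) : Prop :=
  ∀ k < N, ∃ F : Finset (Finset V), (∀ S, S ∈ F ↔ S ∈ A ∧ #S = k) ∧ #F = coeff k f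

theorem countsBelow_singleton_empty (N : ℕ) :
    CountsBelow N ({∅} : Set (Finset V)) 1 := by
  intro k _
  refine ⟨if k = 0 then {∅} else ∅, fun S => ?_, ?_⟩
  · split_ifs with h
    · subst h
      simp
    · simp only [notMem_empty, Set.mem_singleton_iff, false_iff, not_and]
      rintro rfl
      simpa using Ne.symm h
  · rw [coeff_one]
    split_ifs <;> simp

variable [DecidableEq V]

theorem CountsBelow.one_add {N : ℕ} {A : Set (Finset V)} {f : ℕ⟦X⟧} (hA : CountsBelow N A f)
    (hne : ∅ ∉ A) : CountsBelow N (insert ∅ A) (1 + f) := by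
  intro k hk
  obtain ⟨F, hF, hFc⟩ := hA k hk
  obtain ⟨E, hE, hEc⟩ := countsBelow_singleton_empty (V := V) N k hk
  refine ⟨E ∪ F, fun S => ?_, ?_⟩
  · simp only [mem_union, hE, hF, Set.mem_singleton_iff, Set.mem_insert_iff]
    tauto
  · rw [card_union_of_disjoint, hEc, hFc, map_add]
    refine Finset.disjoint_left.2 fun S hS hS' => hne ?_
    rw [← ((hE S).1 hS).1]
    exact ((hF S).1 hS').1

theorem CountsBelow.X_mul {N : ℕ} {A : Set (Finset V)} {f : ℕ⟦X⟧} (hA : CountsBelow N A f)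
    {v : V} (hv : ∀ S ∈ A, v ∉ S) :
    CountsBelow (N + 1) {S | ∃ T ∈ A, S = insert v T} (X * f) := by
  rintro (_ | k) hk
  · refine ⟨∅, fun S => ?_, by simp⟩
    simp only [notMem_empty, Set.mem_ofPred_eq, card_eq_zero, false_iff, not_and]
    rintro ⟨T, _, rfl⟩
    exact insert_ne_empty _ _
  · obtain ⟨F, hF, hFc⟩ := hA k (by omega)
    refine ⟨F.image (insert v), fun S => ?_, ?_⟩
    · simp only [mem_image, hF, Set.mem_ofPred_eq]
      constructor
      · rintro ⟨T, ⟨hT, rfl⟩, rfl⟩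
        exact ⟨⟨T, hT, rfl⟩, card_insert_of_notMem (hv T hT)⟩
      · rintro ⟨⟨T, hT, rfl⟩, hc⟩
        rw [card_insert_of_notMem (hv T hT)] at hc
        exact ⟨T, ⟨hT, by omega⟩, rfl⟩
    · rw [card_image_of_injOn, hFc, coeff_succ_X_mul]
      intro S hS T hT h
      rw [← erase_insert (hv S ((hF S).1 hS).1), ← erase_insert (hv T ((hF T).1 hT).1)]
      exact congrArg (fun U => U.erase v) h

theorem CountsBelow.mul {N : ℕ} {A B : Set (Finset V)} {f g : ℕ⟦X⟧} (hA : CountsBelow N A f)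
    (hB : CountsBelow N B g) {D : Set V} (hAD : ∀ S ∈ A, ∀ w ∈ S, w ∈ D)
    (hBD : ∀ S ∈ B, ∀ w ∈ S, w ∉ D) :
    CountsBelow N {S | ∃ T ∈ A, ∃ U ∈ B, S = T ∪ U} (f * g) := by
  classical
  have hdisj : ∀ T ∈ A, ∀ U ∈ B, Disjoint T U := fun T hT U hU =>
    Finset.disjoint_left.2 fun w hw hw' => hBD U hU w hw' (hAD T hT w hw)
  have hfilter : ∀ T ∈ A, ∀ U ∈ B,
      (T ∪ U).filter (· ∈ D) = T ∧ (T ∪ U).filter (· ∉ D) = U := by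
    intro T hT U hU
    have h₁ := hAD T hT
    have h₂ := hBD U hU
    constructor <;> ext w <;> simp only [mem_filter, mem_union] <;> grind
  intro k hk
  choose! F hF hFc using hA
  choose! E hE hEc using hB
  have key : ∀ p ∈ (antidiagonal k).sigma fun ij => F ij.1 ×ˢ E ij.2,
      (p.2.1 ∈ A ∧ #p.2.1 = p.1.1) ∧ (p.2.2 ∈ B ∧ #p.2.2 = p.1.2) ∧ p.1.1 + p.1.2 = k := by
    intro p hp
    simp only [mem_sigma, HasAntidiagonal.mem_antidiagonal, mem_product] at hp
    exact ⟨(hF _ (by omega) _).1 hp.2.1, (hE _ (by omega) _).1 hp.2.2, hp.1⟩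
  refine ⟨((antidiagonal k).sigma fun ij => F ij.1 ×ˢ E ij.2).image fun p => p.2.1 ∪ p.2.2,
    fun S => ?_, ?_⟩
  · simp only [mem_image, Set.mem_ofPred_eq]
    constructor
    · rintro ⟨p, hp, rfl⟩
      obtain ⟨⟨hT, hT'⟩, ⟨hU, hU'⟩, h⟩ := key p hp
      exact ⟨⟨_, hT, _, hU, rfl⟩, by rw [card_union_of_disjoint (hdisj _ hT _ hU)]; omega⟩
    · rintro ⟨⟨T, hT, U, hU, rfl⟩, hc⟩
      rw [card_union_of_disjoint (hdisj _ hT _ hU)] at hc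
      refine ⟨⟨(#T, #U), (T, U)⟩, ?_, rfl⟩
      simp only [mem_sigma, HasAntidiagonal.mem_antidiagonal, mem_product]
      exact ⟨hc, (hF _ (by omega) _).2 ⟨hT, rfl⟩, (hE _ (by omega) _).2 ⟨hU, rfl⟩⟩
  · rw [card_image_of_injOn, card_sigma, coeff_mul]
    · refine sum_congr rfl fun ij hij => ?_
      have := HasAntidiagonal.mem_antidiagonal.1 hij
      rw [card_product, hFc _ (by omega), hEc _ (by omega)]
    · rintro ⟨⟨i, j⟩, T, U⟩ hp ⟨⟨i', j'⟩, T', U'⟩ hp' h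
      obtain ⟨⟨hT, hi⟩, ⟨hU, hj⟩, -⟩ := key _ hp
      obtain ⟨⟨hT', hi'⟩, ⟨hU', hj'⟩, -⟩ := key _ hp'
      dsimp only at *
      have h₁ := hfilter T hT U hU
      have h₂ := hfilter T' hT' U' hU'
      rw [h] at h₁
      obtain rfl := h₁.1.symm.trans h₂.1
      obtain rfl := h₁.2.symm.trans h₂.2
      subst hi hj hi' hj'
      rfl

end Counting

section Forest

variable {V : Type*} {P : V → V → Prop} {d : V → ℕ}

/-- Finite sets containing `Y` in which every vertex lies in `R` or has a `P`-parent in the set. -/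
def rootedFamily (P : V → V → Prop) (R Y : Set V) : Set (Finset V) :=
  {S | (∀ w ∈ S, w ∈ R ∨ ∃ p ∈ S, P p w) ∧ Y ⊆ S}

theorem exists_reflTransGen_of_mem_rootedFamily (hd : ∀ p w, P p w → d w = d p + 1)
    {R Y : Set V} {S : Finset V} (hS : S ∈ rootedFamily P R Y) {w : V} (hw : w ∈ S) :
    ∃ r ∈ R, r ∈ S ∧ ReflTransGen P r w := by
  induction h : d w generalizing w with
  | zero =>
    obtain hR | ⟨p, _, hp⟩ := hS.1 w hw
    · exact ⟨w, hR, hw, .refl⟩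
    · have := hd p w hp
      omega
  | succ n ih =>
    obtain hR | ⟨p, hpS, hp⟩ := hS.1 w hw
    · exact ⟨w, hR, hw, .refl⟩
    · obtain ⟨r, hr, hrS, hrp⟩ := ih hpS (by have := hd p w hp; omega)
      exact ⟨r, hr, hrS, hrp.tail hp⟩

theorem rootedFamily_empty (hd : ∀ p w, P p w → d w = d p + 1) :
    rootedFamily P ∅ ∅ = {∅} := by
  ext S
  refine ⟨fun hS => ?_, ?_⟩
  · refine Finset.eq_empty_of_forall_notMem fun w hw => ?_
    obtain ⟨r, hr, -⟩ := exists_reflTransGen_of_mem_rootedFamily hd hS hw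
    exact hr
  · rintro rfl
    simp [rootedFamily]

theorem le_of_reflTransGen (hd : ∀ p w, P p w → d w = d p + 1) {a w : V}
    (h : ReflTransGen P a w) : d a ≤ d w ∧ (d w = d a → w = a) := by
  induction h with
  | refl => exact ⟨le_rfl, fun _ => rfl⟩
  | tail _ h ih =>
    have := hd _ _ h
    exact ⟨by omega, fun _ => by omega⟩

theorem eq_of_reflTransGen (hd : ∀ p w, P p w → d w = d p + 1)
    (hu : ∀ p q w, P p w → P q w → p = q) {a b w : V} (hab : d a = d b)
    (ha : ReflTransGen P a w) (hb : ReflTransGen P b w) : a = b := by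
  have hru : Relator.RightUnique (Function.swap P) := fun w p q hp hq => hu p q w hp hq
  rcases ReflTransGen.total_of_right_unique hru (reflTransGen_swap.2 ha)
    (reflTransGen_swap.2 hb) with h | h
  · exact (le_of_reflTransGen hd (reflTransGen_swap.1 h)).2 hab
  · exact ((le_of_reflTransGen hd (reflTransGen_swap.1 h)).2 hab.symm).symm

theorem notMem_of_mem_rootedFamily_children (hd : ∀ p w, P p w → d w = d p + 1) {v : V}
    {Y : Set V} {S : Finset V} (hS : S ∈ rootedFamily P {w | P v w} Y) : v ∉ S := fun hv => by
  obtain ⟨r, hr, -, h⟩ := exists_reflTransGen_of_mem_rootedFamily hd hS hv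
  have := hd _ _ hr
  have := (le_of_reflTransGen hd h).1
  omega

theorem rootedFamily_singleton_insert_self (hd : ∀ p w, P p w → d w = d p + 1) {v y : V} :
    rootedFamily P {v} (insert v {y}) = rootedFamily P {v} {y} := by
  ext S
  refine ⟨fun h => ⟨h.1, (Set.subset_insert _ _).trans h.2⟩,
    fun h => ⟨h.1, Set.insert_subset ?_ h.2⟩⟩
  obtain ⟨r, rfl, hr, -⟩ := exists_reflTransGen_of_mem_rootedFamily hd h (h.2 rfl)
  exact hr

theorem insert_empty_rootedFamily (hd : ∀ p w, P p w → d w = d p + 1) {v : V} :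
    insert ∅ (rootedFamily P {v} {v}) = rootedFamily P {v} ∅ := by
  ext S
  constructor
  · rintro (rfl | h)
    · simp [rootedFamily]
    · exact ⟨h.1, Set.empty_subset _⟩
  · intro h
    obtain rfl | ⟨w, hw⟩ := S.eq_empty_or_nonempty
    · exact Or.inl rfl
    · obtain ⟨r, rfl, hr, -⟩ := exists_reflTransGen_of_mem_rootedFamily hd h hw
      exact Or.inr ⟨h.1, by simpa using hr⟩

variable [DecidableEq V]

theorem rootedFamily_insert (hd : ∀ p w, P p w → d w = d p + 1)
    (hu : ∀ p q w, P p w → P q w → p = q) {a : V} {R Y : Set V} (ha : a ∉ R)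
    (hR : ∀ r ∈ R, d r = d a) (hY : ∀ y ∈ Y, ReflTransGen P a y) :
    rootedFamily P (insert a R) Y =
      {S | ∃ T ∈ rootedFamily P {a} Y, ∃ U ∈ rootedFamily P R ∅, S = T ∪ U} := by
  classical
  ext S
  constructor
  · intro hS
    refine ⟨S.filter (ReflTransGen P a ·), ⟨fun w hw => ?_, fun y hy => ?_⟩,
      S.filter (¬ ReflTransGen P a ·), ⟨fun w hw => ?_, by simp⟩,
      (filter_union_filter_not_eq _ _).symm⟩
    · rw [mem_filter] at hw
      obtain ⟨hwS, haw⟩ := hw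
      obtain rfl | ⟨p, hap, hpw⟩ := ReflTransGen.cases_tail haw
      · exact Or.inl rfl
      · right
        obtain hwR | ⟨q, hq, hqw⟩ := hS.1 w hwS
        · have := (le_of_reflTransGen hd hap).1
          have := hd p w hpw
          obtain rfl | hwR := hwR
          · omega
          · have := hR w hwR
            omega
        · obtain rfl := hu _ _ _ hpw hqw
          exact ⟨p, mem_filter.2 ⟨hq, hap⟩, hpw⟩
    · simpa using ⟨hS.2 hy, hY y hy⟩
    · rw [mem_filter] at hw
      obtain ⟨hwS, haw⟩ := hw
      obtain (rfl | hwR) | ⟨q, hq, hqw⟩ := hS.1 w hwS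
      · exact absurd .refl haw
      · exact Or.inl hwR
      · exact Or.inr ⟨q, mem_filter.2 ⟨hq, fun h => haw (h.tail hqw)⟩, hqw⟩
  · rintro ⟨T, ⟨hT, hYT⟩, U, ⟨hU, -⟩, rfl⟩
    refine ⟨fun w hw => ?_, fun y hy => mem_union_left _ (hYT hy)⟩
    rcases mem_union.1 hw with hw | hw
    · obtain h | ⟨p, hp, h⟩ := hT w hw
      · exact Or.inl (Or.inl h)
      · exact Or.inr ⟨p, mem_union_left _ hp, h⟩
    · obtain h | ⟨p, hp, h⟩ := hU w hw
      · exact Or.inl (Or.inr h)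
      · exact Or.inr ⟨p, mem_union_right _ hp, h⟩

theorem CountsBelow.rootedFamily_insert (hd : ∀ p w, P p w → d w = d p + 1)
    (hu : ∀ p q w, P p w → P q w → p = q) {a : V} {R Y : Set V} (ha : a ∉ R)
    (hR : ∀ r ∈ R, d r = d a) (hY : ∀ y ∈ Y, ReflTransGen P a y) {N : ℕ} {f g : ℕ⟦X⟧}
    (hf : CountsBelow N (rootedFamily P {a} Y) f) (hg : CountsBelow N (rootedFamily P R ∅) g) :
    CountsBelow N (rootedFamily P (insert a R) Y) (f * g) := by
  rw [_root_.rootedFamily_insert hd hu ha hR hY]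
  refine hf.mul hg (D := {w | ReflTransGen P a w}) (fun S hS w hw => ?_) fun S hS w hw haw => ?_
  · obtain ⟨r, rfl, -, h⟩ := exists_reflTransGen_of_mem_rootedFamily hd hS hw
    exact h
  · obtain ⟨r, hr, -, h⟩ := exists_reflTransGen_of_mem_rootedFamily hd hS hw
    obtain rfl := eq_of_reflTransGen hd hu (hR r hr) h haw
    exact ha hr

theorem rootedFamily_singleton {v : V} {Y : Set V} (hv : v ∉ Y) :
    rootedFamily P {v} (insert v Y) =
      {S | ∃ T ∈ rootedFamily P {w | P v w} Y, S = insert v T} := by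
  ext S
  constructor
  · rintro ⟨hS, hYS⟩
    refine ⟨S.erase v, ⟨fun w hw => ?_, fun y hy => ?_⟩,
      (insert_erase (hYS (Set.mem_insert v Y))).symm⟩
    · rw [mem_erase] at hw
      obtain h | ⟨p, hp, h⟩ := hS w hw.2
      · exact absurd h hw.1
      · by_cases hpv : p = v
        · exact Or.inl (hpv ▸ h)
        · exact Or.inr ⟨p, mem_erase.2 ⟨hpv, hp⟩, h⟩
    · exact mem_erase.2 ⟨fun h => hv (h ▸ hy), hYS (Set.mem_insert_of_mem v hy)⟩
  · rintro ⟨T, ⟨hT, hYT⟩, rfl⟩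
    refine ⟨fun w hw => ?_, ?_⟩
    · rcases mem_insert.1 hw with rfl | hw
      · exact Or.inl rfl
      · obtain h | ⟨p, hp, h⟩ := hT w hw
        · exact Or.inr ⟨v, mem_insert_self _ _, h⟩
        · exact Or.inr ⟨p, mem_insert_of_mem hp, h⟩
    · rw [coe_insert]
      exact Set.insert_subset_insert hYT

theorem CountsBelow.rootedFamily_singleton (hd : ∀ p w, P p w → d w = d p + 1)
    {v : V} {Y : Set V} (hv : v ∉ Y) {N : ℕ} {f : ℕ⟦X⟧}
    (hf : CountsBelow N (rootedFamily P {w | P v w} Y) f) :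
    CountsBelow (N + 1) (rootedFamily P {v} (insert v Y)) (X * f) := by
  rw [_root_.rootedFamily_singleton hv]
  exact hf.X_mul fun S hS => notMem_of_mem_rootedFamily_children hd hS

theorem countsBelow_rootedFamily_self
    (hd : ∀ p w, P p w → d w = d p + 1) (hu : ∀ p q w, P p w → P q w → p = q)
    (hc : ∀ v, 0 < d v → {w | P v w}.ncard = 2)
    {N : ℕ}
    (ih : ∀ v, 0 < d v → CountsBelow N (rootedFamily P {v} ∅) catalanSeries) {v : V}
    (hv : 0 < d v) :
    CountsBelow (N + 1) (rootedFamily P {v} {v}) (X * (catalanSeries * catalanSeries)) := by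
  obtain ⟨a, b, hab, hvab⟩ := Set.ncard_eq_two.1 (hc v hv)
  have ha : P v a := hvab.symm.subset (by simp)
  have hb : P v b := hvab.symm.subset (by simp)
  have hda := hd _ _ ha
  have hdb := hd _ _ hb
  have h := CountsBelow.rootedFamily_singleton hd (v := v) (Set.notMem_empty v) (N := N)
    (f := catalanSeries * catalanSeries) (by
      rw [hvab]
      exact CountsBelow.rootedFamily_insert hd hu (by simpa using hab)
        (by rintro r rfl; omega) (by simp) (ih a (by omega)) (ih b (by omega)))
  simpa using h

theorem countsBelow_rootedFamily_catalan
    (hd : ∀ p w, P p w → d w = d p + 1) (hu : ∀ p q w, P p w → P q w → p = q)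
    (hc : ∀ v, 0 < d v → {w | P v w}.ncard = 2)
    (N : ℕ) :
    ∀ v, 0 < d v → CountsBelow N (rootedFamily P {v} ∅) catalanSeries := by
  induction N with
  | zero => exact fun v _ k hk => absurd hk (Nat.not_lt_zero k)
  | succ N ih =>
    intro v hv
    have h := (countsBelow_rootedFamily_self hd hu hc ih hv).one_add
      (fun h => by simpa using h.2)
    rwa [insert_empty_rootedFamily hd,
      show 1 + X * (catalanSeries * catalanSeries) = catalanSeries by
        conv_rhs => rw [← catalanSeries_sq_mul_X_add_one]
        ring] at h

theorem countsBelow_rootedFamily_mem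
    (hd : ∀ p w, P p w → d w = d p + 1) (hu : ∀ p q w, P p w → P q w → p = q)
    (hc : ∀ v, 0 < d v → {w | P v w}.ncard = 2)
    (N j : ℕ) : ∀ v y, 0 < d v → ReflTransGen P v y →
    d y = d v + j → CountsBelow N (rootedFamily P {v} {y})
      (X ^ j * catalanSeries ^ j * (X * (catalanSeries * catalanSeries))) := by
  have up : ∀ {M A} {f : ℕ⟦X⟧}, CountsBelow (V := V) (M + 1) A f → CountsBelow M A f :=
    fun h k hk => h k (by omega)
  induction j with
  | zero =>
    intro v y hv hvy hdy
    obtain rfl := (le_of_reflTransGen hd hvy).2 hdy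
    simpa using up (countsBelow_rootedFamily_self hd hu hc
      (countsBelow_rootedFamily_catalan hd hu hc N) hv)
  | succ j ih =>
    intro v y hv hvy hdy
    obtain rfl | ⟨a, ha, hay⟩ := ReflTransGen.cases_head hvy
    · omega
    obtain ⟨b, hba, hvab⟩ : ∃ b, b ≠ a ∧ {w | P v w} = {a, b} := by
      obtain ⟨p, q, hpq, hvpq⟩ := Set.ncard_eq_two.1 (hc v hv)
      have : a ∈ ({p, q} : Set V) := hvpq.subset ha
      obtain rfl | rfl := this
      · exact ⟨q, hpq.symm, hvpq⟩
      · exact ⟨p, hpq, by rw [hvpq, Set.pair_comm]⟩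
    have hb : P v b := hvab.symm.subset (by simp)
    have hda := hd _ _ ha
    have hdb := hd _ _ hb
    have hvy' : v ∉ ({y} : Set V) := by
      rintro rfl
      omega
    have h := CountsBelow.rootedFamily_singleton hd (v := v) hvy' (N := N)
      (f := X ^ j * catalanSeries ^ j * (X * (catalanSeries * catalanSeries)) * catalanSeries) (by
        rw [hvab]
        exact CountsBelow.rootedFamily_insert hd hu (by simpa using hba.symm)
          (by rintro r rfl; omega) (by rintro z rfl; exact hay)
          (ih a y (by omega) hay (by omega))
          (countsBelow_rootedFamily_catalan hd hu hc N b (by omega)))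
    rw [rootedFamily_singleton_insert_self hd] at h
    convert up h using 1
    ring

theorem countsBelow_rootedFamily_root
    (hd : ∀ p w, P p w → d w = d p + 1) (hu : ∀ p q w, P p w → P q w → p = q)
    (hc : ∀ v, 0 < d v → {w | P v w}.ncard = 2)
    (N k : ℕ) {x y : V} (hx : {w | P x w}.ncard = 3)
    (hxy : ReflTransGen P x y) (hdy : d y = d x + (k + 1)) :
    CountsBelow N (rootedFamily P {x} {y}) (X ^ k *
      ((X * (catalanSeries * catalanSeries)) * (catalanSeries ^ k *
        (X * (catalanSeries * catalanSeries))))) := by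
  obtain rfl | ⟨a, ha, hay⟩ := ReflTransGen.cases_head hxy
  · omega
  obtain ⟨b, c, hab, hac, hbc, hxabc⟩ : ∃ b c, a ≠ b ∧ a ≠ c ∧ b ≠ c ∧
      {w | P x w} = {a, b, c} := by
    have hfin : {w | P x w}.Finite := Set.finite_of_ncard_ne_zero (by omega)
    have h2 : ({w | P x w} \ {a}).ncard = 2 := by
      rw [Set.ncard_sdiff_singleton_of_mem (show a ∈ {w | P x w} from ha), hx]
    obtain ⟨b, c, hbc, h⟩ := Set.ncard_eq_two.1 h2
    have hb : b ∈ {w | P x w} \ {a} := h.symm.subset (by simp)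
    have hc : c ∈ {w | P x w} \ {a} := h.symm.subset (by simp)
    exact ⟨b, c, fun h => hb.2 h.symm, fun h => hc.2 h.symm, hbc,
      by rw [← h, Set.insert_sdiff_singleton, Set.insert_eq_of_mem (show a ∈ {w | P x w} from ha)]⟩
  have hda := hd _ _ ha
  have hdb := hd _ _ (show P x b from hxabc.symm.subset (by simp))
  have hdc := hd _ _ (show P x c from hxabc.symm.subset (by simp))
  have hxy' : x ∉ ({y} : Set V) := by
    rintro rfl
    omega
  have cat := countsBelow_rootedFamily_catalan hd hu hc N
  have h := CountsBelow.rootedFamily_singleton hd hxy' (N := N)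
    (f := X ^ k * catalanSeries ^ k * (X * (catalanSeries * catalanSeries)) *
      (catalanSeries * catalanSeries)) (by
        rw [hxabc]
        refine CountsBelow.rootedFamily_insert hd hu (by simp [hab, hac])
          (by rintro r (rfl | rfl) <;> omega) (by rintro z rfl; exact hay)
          (countsBelow_rootedFamily_mem hd hu hc N k a y (by omega) hay (by omega)) ?_
        exact CountsBelow.rootedFamily_insert hd hu (by simpa using hbc)
          (by rintro r rfl; omega) (by simp) (cat b (by omega)) (cat c (by omega)))
  rw [rootedFamily_singleton_insert_self hd] at h
  intro i hi
  have h' := h i (by omega)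
  rwa [show X * (X ^ k * catalanSeries ^ k * (X * (catalanSeries * catalanSeries)) *
      (catalanSeries * catalanSeries)) = X ^ k *
      ((X * (catalanSeries * catalanSeries)) * (catalanSeries ^ k *
        (X * (catalanSeries * catalanSeries)))) by ring] at h'

end Forest

section Coefficients

theorem sum_antidiagonalTuple_prod_coeff (m : ℕ) (f : Fin m → ℕ⟦X⟧) (n : ℕ) :
    ∑ r ∈ Finset.Nat.antidiagonalTuple m n, ∏ i, coeff (r i) (f i) = coeff n (∏ i, f i) := by
  induction m generalizing n with
  | zero =>
    rcases n with _ | n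
    · simp
    · simp [coeff_one]
  | succ m ih =>
    rw [Fin.prod_univ_succ, coeff_mul]
    simp_rw [← ih, mul_sum]
    rw [sum_sigma']
    refine sum_bij' (fun r _ => ⟨(r 0, ∑ i : Fin m, r i.succ), Fin.tail r⟩)
      (fun p _ => Fin.cons p.1.1 p.2) ?_ ?_ ?_ ?_ ?_
    · intro r hr
      rw [Finset.Nat.mem_antidiagonalTuple, Fin.sum_univ_succ] at hr
      simpa [Finset.Nat.mem_antidiagonalTuple, Fin.tail] using hr
    · rintro ⟨⟨i, j⟩, r⟩ hp
      simp only [mem_sigma, HasAntidiagonal.mem_antidiagonal,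
        Finset.Nat.mem_antidiagonalTuple] at hp ⊢
      rw [Fin.sum_univ_succ]
      simp [hp]
    · intro r _
      simp
    · rintro ⟨⟨i, j⟩, r⟩ hp
      simp only [mem_sigma, HasAntidiagonal.mem_antidiagonal,
        Finset.Nat.mem_antidiagonalTuple] at hp
      simp [hp.2]
    · intro r _
      rw [Fin.prod_univ_succ]
      rfl

theorem coeff_X_mul_catalanSeries_mul_self (n : ℕ) :
    coeff n (X * (catalanSeries * catalanSeries)) = if 1 ≤ n then catalan n else 0 := by
  rcases n with _ | n
  · simp
  · rw [coeff_succ_X_mul, coeff_mul, catalan_succ']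
    simp

theorem Tcount_eq_coeff (n k : ℕ) : Tcount n (k + 2) =
    coeff (n - (k + 2) + 2) ((X * (catalanSeries * catalanSeries)) * (catalanSeries ^ k *
        (X * (catalanSeries * catalanSeries)))) := by
  have hprod : ∏ i : Fin (k + 2), (if (i : ℕ) = 0 ∨ (i : ℕ) = k + 2 - 1 then
      X * (catalanSeries * catalanSeries) else catalanSeries) =
      (X * (catalanSeries * catalanSeries)) * (catalanSeries ^ k *
        (X * (catalanSeries * catalanSeries))) := by
    rw [Fin.prod_univ_succ, Fin.prod_univ_castSucc]
    have : ∀ i : Fin k, (i : ℕ) ≠ k := fun i => i.2.ne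
    simp [this]
  rw [← hprod, ← sum_antidiagonalTuple_prod_coeff, Tcount, sum_filter]
  refine sum_congr rfl fun r _ => ?_
  split_ifs with h
  · refine prod_congr rfl fun i _ => ?_
    split_ifs with hi
    · rw [coeff_X_mul_catalanSeries_mul_self, if_pos (h i hi)]
    · rw [catalanSeries_coeff]
  · push Not at h
    obtain ⟨i, hi, hr⟩ := h
    refine (prod_eq_zero (mem_univ i) ?_).symm
    rw [if_pos hi, coeff_X_mul_catalanSeries_mul_self, if_neg (by omega)]

end Coefficients

namespace SimpleGraph

variable {V : Type*} {G : SimpleGraph V}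

/-- In the tree `G` rooted at `x`, the vertex `p` is the parent of `w`. -/
def IsParent (G : SimpleGraph V) (x p w : V) : Prop :=
  G.Adj p w ∧ G.dist x w = G.dist x p + 1

theorem IsTree.isParent_or_isParent (hG : G.IsTree) (x : V) {v w : V} (h : G.Adj v w) :
    G.IsParent x v w ∨ G.IsParent x w v := by
  rcases hG.dist_eq_dist_add_one_of_adj x h with h' | h'
  · exact Or.inr ⟨h.symm, h'⟩
  · exact Or.inl ⟨h, h'⟩

theorem IsTree.isParent_unique (hG : G.IsTree) {x p q w : V} (hp : G.IsParent x p w)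
    (hq : G.IsParent x q w) : p = q := by
  obtain ⟨P, hP⟩ := hG.connected.exists_walk_length_eq_dist x p
  obtain ⟨Q, hQ⟩ := hG.connected.exists_walk_length_eq_dist x q
  have hP' := (P.concat hp.1).isPath_of_length_eq_dist
    (by rw [Walk.length_concat, hP, hp.2])
  have hQ' := (Q.concat hq.1).isPath_of_length_eq_dist
    (by rw [Walk.length_concat, hQ, hq.2])
  have h := congrArg Walk.penultimate ((hG.existsUnique_path x w).unique hP' hQ')
  simpa using h

theorem Connected.exists_isParent (hG : G.Connected) {x w : V} (hw : w ≠ x) :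
    ∃ p, G.IsParent x p w := by
  obtain ⟨P, hP⟩ := hG.exists_walk_length_eq_dist x w
  have hnil : ¬ P.Nil := Walk.not_nil_of_ne hw.symm
  have hadj := Walk.adj_penultimate hnil
  have hlen : P.dropLast.length + 1 = P.length := by
    rw [← Walk.length_concat _ hadj, Walk.concat_dropLast]
  have h₁ := G.dist_le P.dropLast
  have h₂ := hG.dist_triangle (u := x) (v := P.penultimate) (w := w)
  rw [dist_eq_one_iff_adj.2 hadj] at h₂
  exact ⟨_, hadj, by omega⟩

theorem Connected.reflTransGen_isParent (hG : G.Connected) (x w : V) :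
    ReflTransGen (G.IsParent x) x w := by
  induction h : G.dist x w generalizing w with
  | zero => rw [(hG.dist_eq_zero_iff).1 h]
  | succ n ih =>
    obtain ⟨p, hp⟩ := hG.exists_isParent (x := x) (w := w) (by rintro rfl; simp at h)
    exact (ih p (by have := hp.2; omega)).tail hp

theorem IsTree.ncard_isParent (hG : G.IsTree) {x v : V} (hv : v ≠ x)
    (hfin : (G.neighborSet v).Finite) :
    {w | G.IsParent x v w}.ncard + 1 = (G.neighborSet v).ncard := by
  obtain ⟨p, hp⟩ := hG.connected.exists_isParent hv
  have h : G.neighborSet v = insert p {w | G.IsParent x v w} := by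
    ext w
    constructor
    · intro hw
      rcases hG.isParent_or_isParent x hw with h | h
      · exact Or.inr h
      · exact Or.inl (hG.isParent_unique h hp)
    · rintro (rfl | h)
      · exact hp.1.symm
      · exact h.1
  rw [h, Set.ncard_insert_of_notMem _ (hfin.subset fun w hw => hw.1)]
  rintro ⟨-, h⟩
  have := hp.2
  omega

theorem setOf_isParent_self (x : V) :
    {w | G.IsParent x x w} = G.neighborSet x := by
  ext w
  refine ⟨fun h => h.1, fun h => ⟨h, ?_⟩⟩
  rw [dist_eq_one_iff_adj.2 h, dist_self]

theorem IsTree.induce_connected_iff (hG : G.IsTree) {x : V} {S : Set V} (hx : x ∈ S) :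
    (G.induce S).Connected ↔ ∀ w ∈ S, w = x ∨ ∃ p ∈ S, G.IsParent x p w := by
  classical
  constructor
  · intro hS w hw
    refine or_iff_not_imp_left.2 fun hwx => ?_
    obtain ⟨W, hW⟩ := hS.exists_isPath ⟨x, hx⟩ ⟨w, hw⟩
    have hWp := hW.map (f := (Embedding.induce S).toHom) Subtype.val_injective
    obtain ⟨p, hp⟩ := hG.connected.exists_isParent hwx
    obtain ⟨P, hP⟩ := hG.connected.exists_walk_length_eq_dist x p
    have hP' := (P.concat hp.1).isPath_of_length_eq_dist
      (by rw [Walk.length_concat, hP, hp.2])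
    refine ⟨p, ?_, hp⟩
    have h := (hG.existsUnique_path x w).unique hP' hWp
    have hpP : p ∈ (P.concat hp.1).support := by
      rw [Walk.support_concat]
      simp
    have hpW : p ∈ (W.map (Embedding.induce S).toHom).support := by
      rwa [h] at hpP
    rw [Walk.support_map, List.mem_map] at hpW
    obtain ⟨q, -, rfl⟩ := hpW
    exact q.2
  · intro h
    have key : ∀ n, ∀ w (hw : w ∈ S), G.dist x w = n →
        (G.induce S).Reachable ⟨x, hx⟩ ⟨w, hw⟩ := by
      intro n
      induction n with
      | zero =>
        intro w hw h0
        obtain rfl := hG.connected.dist_eq_zero_iff.1 h0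
        rfl
      | succ n ih =>
        intro w hw hn
        obtain rfl | ⟨p, hpS, hp⟩ := h w hw
        · rfl
        · refine (ih p hpS (by have := hp.2; omega)).trans (Adj.reachable ?_)
          exact hp.1
    exact (connected_iff_exists_forall_reachable _).2 ⟨⟨x, hx⟩, fun w => key _ w.1 w.2 rfl⟩

end SimpleGraph

/-- Let Γ be a Cayley tree of order 2, m ≥ 2, and x, y two vertices at graph
distance m−1. Then for every n ≥ m, the number of n-element subsets S of V containing x
and y whose induced subgraph is connected equals T(n,m). -/
theorem stmt_10 {V : Type*} (G : SimpleGraph V)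
    (hconn : G.Connected) (hacyc : G.IsAcyclic)
    (hdeg : ∀ v : V, (G.neighborSet v).ncard = 3)
    (m : ℕ) (hm : 2 ≤ m) (x y : V) (hdist : G.dist x y = m - 1) :
    ∀ n : ℕ, m ≤ n →
      {S : Set V | S.Finite ∧ S.ncard = n ∧ x ∈ S ∧ y ∈ S ∧ (G.induce S).Connected}.ncard =
        Tcount n m := by
  classical
  intro n hn
  have hG : G.IsTree := ⟨hconn, hacyc⟩
  obtain ⟨k, rfl⟩ := Nat.exists_eq_add_of_le' hm
  have hd : ∀ p w, G.IsParent x p w → G.dist x w = G.dist x p + 1 := fun _ _ h => h.2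
  obtain ⟨F, hF, hFc⟩ := countsBelow_rootedFamily_root hd
    (fun _ _ _ => hG.isParent_unique)
    (fun v hv => by
      have := hG.ncard_isParent (x := x) (v := v) (by rintro rfl; simp at hv)
        (Set.finite_of_ncard_ne_zero (by rw [hdeg]; decide))
      have := hdeg v
      omega)
    (n + 1) k (x := x) (y := y) (by rw [SimpleGraph.setOf_isParent_self, hdeg])
    (hconn.reflTransGen_isParent x y) (by simpa using hdist) n (Nat.lt_succ_self n)
  have hset : {S : Set V | S.Finite ∧ S.ncard = n ∧ x ∈ S ∧ y ∈ S ∧ (G.induce S).Connected} =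
      (fun S : Finset V => (S : Set V)) '' F := by
    ext S
    constructor
    · rintro ⟨hfin, hcard, hxS, hyS, hS⟩
      lift S to Finset V using hfin
      rw [Set.ncard_coe_finset] at hcard
      exact ⟨S, (hF S).2 ⟨⟨(hG.induce_connected_iff hxS).1 hS, by simpa using hyS⟩, hcard⟩, rfl⟩
    · rintro ⟨T, hT, rfl⟩
      obtain ⟨hT, hcard⟩ := (hF T).1 hT
      have hyT : y ∈ T := hT.2 rfl
      obtain ⟨r, rfl, hxT, -⟩ := exists_reflTransGen_of_mem_rootedFamily hd hT hyT
      exact ⟨T.finite_toSet, by rw [Set.ncard_coe_finset, hcard], hxT, hyT,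
        (hG.induce_connected_iff (mem_coe.2 hxT)).2 hT.1⟩
  rw [hset, Set.ncard_image_of_injective _ coe_injective, Set.ncard_coe_finset, hFc,
    Tcount_eq_coeff]
  conv_lhs => rw [show n = n - (k + 2) + 2 + k by omega]
  rw [coeff_X_pow_mul]
end
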